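/- arXiv:1509.03129 — 5 statements merged into one kernel-verified Lean document; each statement's English description precedes it below -/
import Mathlib

section
/- Let A_{ij;k}(x_{ij},x_{ik},x_{jk}) = α_{ij;k} x_{ik} x_{jk} + β^{(i)}_{ij;k} x_{ij} x_{ik} + β^{(j)}_{ij;k} x_{ij} x_{jk} + λ_{ij;k} x_{ij}² + μ^{(i)}_{ij;k} x_{ik}² + μ^{(j)}_{ij;k} x_{jk}² be a family of quadratic polynomials indexed by labels (ij;k) with i,j,k ∈ {1,2,3,4}, satisfying the system (A2). Then α_{ij;ℓ}·λ_{ij;k} = 0 for all {i,j,k,ℓ} = {1,2,3,4}. -/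
/- Statement 3: For a family of quadratic polynomials
   `A_{ij;k} = α_{ij;k} x_{ik} x_{jk} + β^{(i)}_{ij;k} x_{ij} x_{ik} + β^{(j)}_{ij;k} x_{ij} x_{jk}
              + λ_{ij;k} x_{ij}² + μ^{(i)}_{ij;k} x_{ik}² + μ^{(j)}_{ij;k} x_{jk}²`
   satisfying the system (A2), one has `α_{ij;ℓ} λ_{ij;k} = 0` for all `{i,j,k,ℓ} = {1,2,3,4}`. -/

noncomputable section

open MvPolynomial

/-- The variable index of `x_{ij} = x_{ji}`: the sorted pair. -/
def vd (i j : Fin 4) : Fin 4 × Fin 4 := if i ≤ j then (i, j) else (j, i)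

/-- The variable `x_{ij}` in the polynomial ring in the six variables `x_{pq}`. -/
def xv (i j : Fin 4) : MvPolynomial (Fin 4 × Fin 4) ℝ := X (vd i j)

/-- The quadratic polynomial `A_{ij;k}`, written out in the six variables `x_{pq}`.
    Here `β i j k` denotes `β^{(i)}_{ij;k}` and `μ i j k` denotes `μ^{(i)}_{ij;k}`;
    the symmetry convention `A_{ij;k} = A_{ji;k}` then swaps the superscripts. -/
def quadA (α β lam μ : Fin 4 → Fin 4 → Fin 4 → ℝ) (i j k : Fin 4) :
    MvPolynomial (Fin 4 × Fin 4) ℝ :=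
  C (α i j k) * xv i k * xv j k + C (β i j k) * xv i j * xv i k +
    C (β j i k) * xv i j * xv j k + C (lam i j k) * xv i j ^ 2 +
    C (μ i j k) * xv i k ^ 2 + C (μ j i k) * xv j k ^ 2

/-- The system (A2), as an identity in the six variables `x_{pq}`,
    for every `{i,j,k,ℓ} = {1,2,3,4}`. -/
def SystemA2 (A : Fin 4 → Fin 4 → Fin 4 → MvPolynomial (Fin 4 × Fin 4) ℝ) : Prop :=
  ∀ i j k l : Fin 4, ({i, j, k, l} : Finset (Fin 4)) = Finset.univ →
    pderiv (vd i j) (A i j k) * A i j l + pderiv (vd i k) (A i j k) * A i k l +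
        pderiv (vd j k) (A i j k) * A j k l =
      pderiv (vd i j) (A i j l) * A i j k + pderiv (vd i l) (A i j l) * A i l k +
        pderiv (vd j l) (A i j l) * A j l k

theorem vd_eq_iff : ∀ i j k l : Fin 4,
    vd i j = vd k l ↔ (i = k ∧ j = l) ∨ (i = l ∧ j = k) := by
  decide

theorem pairwise_ne_of_eq_univ : ∀ i j k l : Fin 4,
    ({i, j, k, l} : Finset (Fin 4)) = Finset.univ →
      i ≠ j ∧ i ≠ k ∧ i ≠ l ∧ j ≠ k ∧ j ≠ l ∧ k ≠ l := by
  decide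

/-- The identity (A2) restricted to the subspace `x_{ik} = x_{jk} = x_{kl} = 0`. -/
theorem SystemA2.restrict {α β lam μ : Fin 4 → Fin 4 → Fin 4 → ℝ}
    (hA2 : SystemA2 (quadA α β lam μ)) {i j k l : Fin 4}
    (h : ({i, j, k, l} : Finset (Fin 4)) = Finset.univ) (x u v : ℝ) :
    2 * lam i j k * x * (α i j l * u * v + β i j l * x * u + β j i l * x * v +
          lam i j l * x ^ 2 + μ i j l * u ^ 2 + μ j i l * v ^ 2) +
        β i j k * x * (μ i k l * u ^ 2) + β j i k * x * (μ j k l * v ^ 2) =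
      (β i j l * u + β j i l * v + 2 * lam i j l * x) * (lam i j k * x ^ 2) +
        (α i j l * v + β i j l * x + 2 * μ i j l * u) * (lam i l k * u ^ 2) +
        (α i j l * u + β j i l * x + 2 * μ j i l * v) * (lam j l k * v ^ 2) := by
  obtain ⟨hij, hik, hil, hjk, hjl, hkl⟩ := pairwise_ne_of_eq_univ i j k l h
  have key := congrArg (eval fun p => if p = vd i j then x else if p = vd i l then u
    else if p = vd j l then v else 0) (hA2 i j k l h)
  simp [quadA, xv, pderiv_X, vd_eq_iff, hij, hik, hil, hjk, hjl, hkl,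
    hij.symm, hik.symm, hil.symm, hjk.symm, hjl.symm] at key
  linear_combination key

theorem stmt_3 (α β lam μ : Fin 4 → Fin 4 → Fin 4 → ℝ)
    (hα : ∀ i j k, α i j k = α j i k) (hlam : ∀ i j k, lam i j k = lam j i k)
    (hA2 : SystemA2 (quadA α β lam μ)) :
    ∀ i j k l : Fin 4, ({i, j, k, l} : Finset (Fin 4)) = Finset.univ →
      α i j l * lam i j k = 0 := by
  intro i j k l h
  have restrict := hA2.restrict h
  linear_combination (1 / 8) * (restrict 1 1 1 - restrict 1 1 (-1) - restrict 1 (-1) 1 +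
    restrict 1 (-1) (-1))

end
end

section
/- Fix an integer m ≥ 2. A family of homogeneous polynomials A_{ij;k}(x_{ij},x_{ik},x_{jk}) of degree m+1 over ℝ, indexed by labels (ij;k) with i,j,k ∈ {1,2,3,4} and satisfying A_{ij;k} = A_{ji;k}, satisfies the homogeneous linear system (H): x_{ik}·A_{jk;ℓ} + x_{jk}·A_{ik;ℓ} + x_{iℓ} x_{jℓ}·∂A_{ij;k}/∂x_{ij} + x_{iℓ} x_{kℓ}·∂A_{ij;k}/∂x_{ik} + x_{jℓ} x_{kℓ}·∂A_{ij;k}/∂x_{jk} − x_{iℓ}·A_{jℓ;k} − x_{jℓ}·A_{iℓ;k} − x_{ik} x_{jk}·∂A_{ij;ℓ}/∂x_{ij} − x_{ik} x_{kℓ}·∂A_{ij;ℓ}/∂x_{iℓ} − x_{jk} x_{kℓ}·∂A_{ij;ℓ}/∂x_{jℓ} = 0 identically in the six variables x_{pq} = x_{qp}, for all {i,j,k,ℓ} = {1,2,3,4} (each A_{pq;r} evaluated at (x_{pq}, x_{pr}, x_{qr})), if and only if there exist real constants b_{ij} = b_{ji} (1 ≤ i < j ≤ 4) such that A_{ij;k}(x_{ij},x_{ik},x_{jk})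 = x_{ik} x_{jk}·( m·b_{ij}·x_{ij}^{m−1} − b_{ik}·x_{ik}^{m−1} − b_{jk}·x_{jk}^{m−1} ) for all labels (ij;k). -/
/- Statement 6: the general solution of the homogeneous linear system (H) for a family of
   homogeneous polynomials `A_{ij;k}(x_{ij},x_{ik},x_{jk})` of degree `m+1` is
   `A_{ij;k} = x_{ik} x_{jk} (m b_{ij} x_{ij}^{m-1} - b_{ik} x_{ik}^{m-1} - b_{jk} x_{jk}^{m-1})`. -/

noncomputable section

open MvPolynomial

/-- Evaluation of the three-variable polynomial `A_{ij;k}` at `(x_{ij}, x_{ik}, x_{jk})`,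
    as a polynomial in the six variables `x_{pq}`. -/
def ev (A : Fin 4 → Fin 4 → Fin 4 → MvPolynomial (Fin 3) ℝ) (i j k : Fin 4) :
    MvPolynomial (Fin 4 × Fin 4) ℝ :=
  aeval ![xv i j, xv i k, xv j k] (A i j k)

/-- The homogeneous linear system (H), as an identity in the six variables `x_{pq}`,
    for every `{i,j,k,ℓ} = {1,2,3,4}`. Since the three substituted variables are distinct,
    the partial derivative of `A_{ij;k}` with respect to its argument `x_{ij}`, evaluated at
    `(x_{ij}, x_{ik}, x_{jk})`, is `pderiv (vd i j)` of the evaluated polynomial, etc. -/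
def SystemH (A : Fin 4 → Fin 4 → Fin 4 → MvPolynomial (Fin 3) ℝ) : Prop :=
  ∀ i j k l : Fin 4, ({i, j, k, l} : Finset (Fin 4)) = Finset.univ →
    xv i k * ev A j k l + xv j k * ev A i k l +
        xv i l * xv j l * pderiv (vd i j) (ev A i j k) +
        xv i l * xv k l * pderiv (vd i k) (ev A i j k) +
        xv j l * xv k l * pderiv (vd j k) (ev A i j k) -
        xv i l * ev A j l k - xv j l * ev A i l k -
        xv i k * xv j k * pderiv (vd i j) (ev A i j l) -
        xv i k * xv k l * pderiv (vd i l) (ev A i j l) -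
        xv j k * xv k l * pderiv (vd j l) (ev A i j l) = 0

/-- The coefficient of `p` at the monomial with exponent vector `n`. -/
def coeffAt {σ : Type*} [Finite σ] (p : MvPolynomial σ ℝ) (n : σ → ℕ) : ℝ :=
  coeff (Finsupp.equivFunOnFinite.symm n) p

section coeffAt

variable {σ τ : Type*} [Finite σ] [Finite τ]

lemma coeffAt_add (p q : MvPolynomial σ ℝ) (n : σ → ℕ) :
    coeffAt (p + q) n = coeffAt p n + coeffAt q n := coeff_add _ _ _

lemma coeffAt_sub (p q : MvPolynomial σ ℝ) (n : σ → ℕ) :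
    coeffAt (p - q) n = coeffAt p n - coeffAt q n := coeff_sub _ _ _ _

lemma coeffAt_zero (n : σ → ℕ) : coeffAt (0 : MvPolynomial σ ℝ) n = 0 := coeff_zero _

lemma coeffAt_C_mul (c : ℝ) (p : MvPolynomial σ ℝ) (n : σ → ℕ) :
    coeffAt (C c * p) n = c * coeffAt p n := coeff_C_mul _ _ _

lemma coeffAt_X_mul [DecidableEq σ] (a : σ) (p : MvPolynomial σ ℝ) (n : σ → ℕ) :
    coeffAt (X a * p) n =
      if n a = 0 then 0 else coeffAt p (Function.update n a (n a - 1)) := by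
  unfold coeffAt
  rw [coeff_X_mul']
  by_cases h : n a = 0
  · simp [h]
  · rw [if_pos (by simpa using h), if_neg h]
    congr 1
    ext x
    by_cases hx : x = a
    · subst hx; simp
    · simp [hx]

lemma coeffAt_X_pow [DecidableEq σ] (a : σ) (k : ℕ) (n : σ → ℕ)
    [Decidable (n = Pi.single a k)] :
    coeffAt (X a ^ k) n = if n = Pi.single a k then 1 else 0 := by
  unfold coeffAt
  rw [coeff_X_pow]
  congr 1
  rw [eq_iff_iff, Equiv.eq_symm_apply, Finsupp.equivFunOnFinite_single, eq_comm]

lemma coeffAt_pderiv [DecidableEq σ] (a : σ) (p : MvPolynomial σ ℝ) (n : σ → ℕ) :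
    coeffAt (pderiv a p) n = coeffAt p (Function.update n a (n a + 1)) * (n a + 1) := by
  unfold coeffAt
  rw [coeff_pderiv]
  congr 2
  ext x
  by_cases hx : x = a
  · subst hx; simp
  · simp [hx]

lemma coeffAt_rename {f : σ → τ} (hf : Function.Injective f) (p : MvPolynomial σ ℝ)
    (n : τ → ℕ) [Decidable (∀ x, (∀ y, f y ≠ x) → n x = 0)] :
    coeffAt (rename f p) n =
      if ∀ x, (∀ y, f y ≠ x) → n x = 0 then coeffAt p (n ∘ f) else 0 := by
  unfold coeffAt
  split_ifs with h
  · rw [← coeff_rename_mapDomain f hf]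
    congr 1
    ext x
    by_cases hx : ∃ y, f y = x
    · obtain ⟨y, rfl⟩ := hx
      simp [Finsupp.mapDomain_apply hf]
    · push Not at hx
      rw [Finsupp.mapDomain_of_notMem_range _ _ (by simpa using hx)]
      simpa using h x hx
  · apply coeff_rename_eq_zero
    rintro u hu
    exfalso
    apply h
    intro x hx
    have := Finsupp.mapDomain_of_notMem_range (f := f) u x (by simpa using hx)
    rw [hu] at this
    simpa using this

lemma coeffAt_rename_vec [DecidableEq σ] [Fintype σ] {a b c : σ} (hab : a ≠ b) (hac : a ≠ c)
    (hbc : b ≠ c) (p : MvPolynomial (Fin 3) ℝ) (n : σ → ℕ) :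
    coeffAt (rename ![a, b, c] p) n =
      if ∀ x, a ≠ x ∧ b ≠ x ∧ c ≠ x → n x = 0 then coeffAt p ![n a, n b, n c] else 0 := by
  classical
  have hf : Function.Injective ![a, b, c] := by
    intro x y
    fin_cases x <;> fin_cases y <;> simp [hab, hac, hbc, hab.symm, hac.symm, hbc.symm]
  have hn : n ∘ ![a, b, c] = ![n a, n b, n c] := by
    ext x
    fin_cases x <;> rfl
  simp [coeffAt_rename hf, hn, Fin.forall_fin_succ]

end coeffAt

/-- The left side of (H) for `(i, j, k, l)` in the variables
`x_{ij}, x_{ik}, x_{jk}, x_{il}, x_{jl}, x_{kl}`, numbered from `0` to `5`. -/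
def sixVarForm (F G P₁ P₂ Q₁ Q₂ : MvPolynomial (Fin 3) ℝ) : MvPolynomial (Fin 6) ℝ :=
  X 1 * rename ![2, 4, 5] P₁ + X 2 * rename ![1, 3, 5] P₂ +
    X 3 * (X 4 * pderiv 0 (rename ![0, 1, 2] F)) +
    X 3 * (X 5 * pderiv 1 (rename ![0, 1, 2] F)) +
    X 4 * (X 5 * pderiv 2 (rename ![0, 1, 2] F)) -
    X 3 * rename ![4, 2, 5] Q₁ - X 4 * rename ![3, 1, 5] Q₂ -
    X 1 * (X 2 * pderiv 0 (rename ![0, 3, 4] G)) -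
    X 1 * (X 5 * pderiv 3 (rename ![0, 3, 4] G)) -
    X 2 * (X 5 * pderiv 4 (rename ![0, 3, 4] G))

/-- The six edges of the tetrahedron `ijkl`. -/
def edge (i j k l : Fin 4) : Fin 6 → Fin 4 × Fin 4 :=
  ![vd i j, vd i k, vd j k, vd i l, vd j l, vd k l]

lemma vd_comm (i j : Fin 4) : vd i j = vd j i := by
  revert i j; decide

lemma edge_injective {i j k l : Fin 4}
    (h : ({i, j, k, l} : Finset (Fin 4)) = Finset.univ) :
    Function.Injective (edge i j k l) := by
  revert i j k l; decide +kernel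

lemma ne_of_eq_univ {i j k l : Fin 4} (h : ({i, j, k, l} : Finset (Fin 4)) = Finset.univ) :
    i ≠ j ∧ i ≠ k ∧ i ≠ l ∧ j ≠ k ∧ j ≠ l ∧ k ≠ l := by
  revert i j k l; decide

lemma ev_eq_rename (A : Fin 4 → Fin 4 → Fin 4 → MvPolynomial (Fin 3) ℝ) (i j k : Fin 4) :
    ev A i j k = rename ![vd i j, vd i k, vd j k] (A i j k) := by
  rw [ev, rename_eq_aeval]
  congr 2
  ext x : 1
  fin_cases x <;> rfl

/-- The system (H), written in six variables numbered from `0` to `5`. -/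
def SixVarSystem (A : Fin 4 → Fin 4 → Fin 4 → MvPolynomial (Fin 3) ℝ) : Prop :=
  ∀ i j k l : Fin 4, ({i, j, k, l} : Finset (Fin 4)) = Finset.univ →
    sixVarForm (A i j k) (A i j l) (A j k l) (A i k l) (A j l k) (A i l k) = 0

/-- The symmetry `A_{ji;k} = A_{ij;k}`. -/
def SwapSymmetric (A : Fin 4 → Fin 4 → Fin 4 → MvPolynomial (Fin 3) ℝ) : Prop :=
  ∀ i j k : Fin 4, i ≠ j → i ≠ k → j ≠ k →
    A j i k = rename (Equiv.swap (1 : Fin 3) 2) (A i j k)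

lemma systemH_iff (A : Fin 4 → Fin 4 → Fin 4 → MvPolynomial (Fin 3) ℝ) :
    SystemH A ↔ SixVarSystem A := by
  refine forall₄_congr fun i j k l => forall_congr' fun h => ?_
  have hinj := edge_injective h
  rw [← map_eq_zero_iff _ (rename_injective _ hinj)]
  refine Eq.congr_left ?_
  have key (a b c : Fin 6) (p : MvPolynomial (Fin 3) ℝ) :
      rename ![edge i j k l a, edge i j k l b, edge i j k l c] p =
        rename (edge i j k l) (rename ![a, b, c] p) := by
    rw [rename_rename]
    congr 2
    ext x : 1
    fin_cases x <;> rfl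
  have e0 : vd i j = edge i j k l 0 := rfl
  have e1 : vd i k = edge i j k l 1 := rfl
  have e2 : vd j k = edge i j k l 2 := rfl
  have e3 : vd i l = edge i j k l 3 := rfl
  have e4 : vd j l = edge i j k l 4 := rfl
  have e5 : vd k l = edge i j k l 5 := rfl
  have e5' : vd l k = edge i j k l 5 := vd_comm _ _
  simp only [sixVarForm, ev_eq_rename, xv, e0, e1, e2, e3, e4, e5, e5', key,
    pderiv_rename hinj, map_add, map_sub, map_mul, rename_X]
  ring

section coefficients

variable {F G P₁ P₂ Q₁ Q₂ : MvPolynomial (Fin 3) ℝ}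

lemma coeffAt_sixVarForm (h : sixVarForm F G P₁ P₂ Q₁ Q₂ = 0) (n : Fin 6 → ℕ) :
    coeffAt (sixVarForm F G P₁ P₂ Q₁ Q₂) n = 0 := by
  rw [h, coeffAt_zero]

lemma coeffAt_high_eq_zero (h : sixVarForm F G P₁ P₂ Q₁ Q₂ = 0) {s t w : ℕ}
    (htw : ¬ (t = 1 ∧ w = 1)) : coeffAt F ![s + 2, t, w] = 0 := by
  have := coeffAt_sixVarForm h ![s + 1, t, w, 1, 1, 0]
  simp [sixVarForm, coeffAt_add, coeffAt_sub, coeffAt_X_mul, coeffAt_pderiv,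
    coeffAt_rename_vec, Fin.forall_fin_succ, Function.update_apply] at this
  have hF : coeffAt F ![s + 2, t, w] * (s + 1 + 1) = 0 := by grind
  exact (mul_eq_zero.mp hF).resolve_right (by positivity)

lemma coeffAt_high_congr (h : sixVarForm F G P₁ P₂ Q₁ Q₂ = 0) (s : ℕ) :
    coeffAt F ![s + 1, 1, 1] = coeffAt G ![s + 1, 1, 1] := by
  have := coeffAt_sixVarForm h ![s, 1, 1, 1, 1, 0]
  simp [sixVarForm, coeffAt_add, coeffAt_sub, coeffAt_X_mul, coeffAt_pderiv,
    coeffAt_rename_vec, Fin.forall_fin_succ, Function.update_apply] at this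
  have hs : (s + 1 : ℝ) ≠ 0 := by positivity
  exact mul_right_cancel₀ hs (sub_eq_zero.mp this)

lemma coeffAt_one_eq_zero (h : sixVarForm F G P₁ P₂ Q₁ Q₂ = 0) {t w : ℕ}
    (htw : 2 ≤ t + w) : coeffAt F ![1, t + 1, w] = 0 := by
  have := coeffAt_sixVarForm h ![1, t, w, 1, 0, 1]
  simp [sixVarForm, coeffAt_add, coeffAt_sub, coeffAt_X_mul, coeffAt_pderiv,
    coeffAt_rename_vec, Fin.forall_fin_succ, Function.update_apply] at this
  have hF : coeffAt F ![1, t + 1, w] * (t + 1) = 0 := by grind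
  exact (mul_eq_zero.mp hF).resolve_right (by positivity)

lemma coeffAt_zero_eq_zero (h : sixVarForm F G P₁ P₂ Q₁ Q₂ = 0) {t w : ℕ}
    (ht : 1 ≤ t) (htw : 2 ≤ t + w) (hw : w ≠ 1) : coeffAt F ![0, t + 1, w] = 0 := by
  have := coeffAt_sixVarForm h ![0, t, w, 1, 0, 1]
  simp [sixVarForm, coeffAt_add, coeffAt_sub, coeffAt_X_mul, coeffAt_pderiv,
    coeffAt_rename_vec, Fin.forall_fin_succ, Function.update_apply] at this
  have hF : coeffAt F ![0, t + 1, w] * (t + 1) = 0 := by grind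
  exact (mul_eq_zero.mp hF).resolve_right (by positivity)

lemma coeffAt_zero_add (h : sixVarForm F G P₁ P₂ Q₁ Q₂ = 0) {t : ℕ} (ht : 1 ≤ t) :
    (t + 1) * coeffAt F ![0, t + 1, 1] + coeffAt P₂ ![t, 1, 1] = 0 := by
  have := coeffAt_sixVarForm h ![0, t, 1, 1, 0, 1]
  simp [sixVarForm, coeffAt_add, coeffAt_sub, coeffAt_X_mul, coeffAt_pderiv,
    coeffAt_rename_vec, Fin.forall_fin_succ, Function.update_apply] at this
  grind

lemma coeffAt_square_congr (h : sixVarForm F G P₁ P₂ Q₁ Q₂ = 0) :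
    coeffAt F ![1, 2, 0] = coeffAt Q₂ ![1, 2, 0] := by
  have := coeffAt_sixVarForm h ![0, 2, 0, 1, 1, 0]
  simp [sixVarForm, coeffAt_add, coeffAt_sub, coeffAt_X_mul, coeffAt_pderiv,
    coeffAt_rename_vec, Fin.forall_fin_succ, Function.update_apply] at this
  exact sub_eq_zero.mp this

lemma coeffAt_square_add (h : sixVarForm F G P₁ P₂ Q₁ Q₂ = 0) :
    coeffAt P₁ ![1, 0, 2] + coeffAt P₂ ![1, 0, 2] = 0 := by
  have := coeffAt_sixVarForm h ![0, 1, 1, 0, 0, 2]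
  simp [sixVarForm, coeffAt_add, coeffAt_sub, coeffAt_X_mul, coeffAt_pderiv,
    coeffAt_rename_vec, Fin.forall_fin_succ, Function.update_apply] at this
  exact this

end coefficients

lemma sixVarForm_eq_zero (n : ℕ) (a b c d e f : ℝ) :
    sixVarForm
      (X 1 * X 2 * (C ((n + 2 : ℝ) * a) * X 0 ^ (n + 1) - C b * X 1 ^ (n + 1) -
        C c * X 2 ^ (n + 1)))
      (X 1 * X 2 * (C ((n + 2 : ℝ) * a) * X 0 ^ (n + 1) - C d * X 1 ^ (n + 1) -
        C e * X 2 ^ (n + 1)))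
      (X 1 * X 2 * (C ((n + 2 : ℝ) * c) * X 0 ^ (n + 1) - C e * X 1 ^ (n + 1) -
        C f * X 2 ^ (n + 1)))
      (X 1 * X 2 * (C ((n + 2 : ℝ) * b) * X 0 ^ (n + 1) - C d * X 1 ^ (n + 1) -
        C f * X 2 ^ (n + 1)))
      (X 1 * X 2 * (C ((n + 2 : ℝ) * e) * X 0 ^ (n + 1) - C c * X 1 ^ (n + 1) -
        C f * X 2 ^ (n + 1)))
      (X 1 * X 2 * (C ((n + 2 : ℝ) * d) * X 0 ^ (n + 1) - C b * X 1 ^ (n + 1) -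
        C f * X 2 ^ (n + 1))) = 0 := by
  have hC : (C (2 : ℝ) : MvPolynomial (Fin 6) ℝ) = 2 := map_ofNat C 2
  simp [sixVarForm, pderiv_X]
  rw [hC]
  ring

/-- An index distinct from `i` and `j`, symmetric in the two. -/
def thirdIndex (i j : Fin 4) : Fin 4 :=
  if i ≠ 0 ∧ j ≠ 0 then 0 else if i ≠ 1 ∧ j ≠ 1 then 1 else 2

lemma thirdIndex_comm (i j : Fin 4) : thirdIndex i j = thirdIndex j i := by
  revert i j; decide

lemma eq_thirdIndex_or {i j k : Fin 4} (hij : i ≠ j) (hik : i ≠ k) (hjk : j ≠ k) :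
    k = thirdIndex i j ∨ ({i, j, k, thirdIndex i j} : Finset (Fin 4)) = Finset.univ := by
  revert i j k; decide

lemma thirdIndex_ne (i j : Fin 4) : i ≠ thirdIndex i j ∧ j ≠ thirdIndex i j := by
  revert i j; decide

lemma exists_eq_univ {i j k : Fin 4} (hij : i ≠ j) (hik : i ≠ k) (hjk : j ≠ k) :
    ∃ l, ({i, j, k, l} : Finset (Fin 4)) = Finset.univ := by
  revert i j k; decide

lemma swap_first {i j k l : Fin 4} (h : ({i, j, k, l} : Finset (Fin 4)) = Finset.univ) :
    ({j, i, k, l} : Finset (Fin 4)) = Finset.univ := by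
  rw [← h, Finset.insert_comm]

lemma rotate {i j k l : Fin 4} (h : ({i, j, k, l} : Finset (Fin 4)) = Finset.univ) :
    ({k, j, l, i} : Finset (Fin 4)) = Finset.univ := by
  revert i j k l; decide

section solution

variable {A : Fin 4 → Fin 4 → Fin 4 → MvPolynomial (Fin 3) ℝ}

lemma coeffAt_swap (hsym : SwapSymmetric A)
    {i j k : Fin 4} (hij : i ≠ j) (hik : i ≠ k) (hjk : j ≠ k) (s t w : ℕ) :
    coeffAt (A j i k) ![s, t, w] = coeffAt (A i j k) ![s, w, t] := by
  rw [hsym i j k hij hik hjk, coeffAt_rename (Equiv.injective _), if_pos]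
  · congr 1
    ext x
    fin_cases x <;> rfl
  · intro x hx
    exact absurd ((Equiv.swap 1 2).apply_symm_apply x) (hx _)

lemma coeffAt_square_eq_zero (hsym : SwapSymmetric A) (hA : SixVarSystem A)
    {i j k l : Fin 4}
    (h : ({i, j, k, l} : Finset (Fin 4)) = Finset.univ) :
    coeffAt (A i j k) ![1, 2, 0] = 0 := by
  have h' : ({l, j, i, k} : Finset (Fin 4)) = Finset.univ := rotate (rotate h)
  obtain ⟨-, hli, hlk, hji, hjk, hik⟩ := ne_of_eq_univ h'
  have hadd := coeffAt_square_add (hA _ _ _ _ h')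
  rw [coeffAt_swap hsym hji.symm hik hjk, coeffAt_swap hsym hli.symm hik hlk] at hadd
  linarith [coeffAt_square_congr (hA _ _ _ _ h)]

lemma coeffAt_eq_zero (hsym : SwapSymmetric A) (hA : SixVarSystem A)
    {m : ℕ} (hm : 2 ≤ m) {i j k l : Fin 4}
    (h : ({i, j, k, l} : Finset (Fin 4)) = Finset.univ) {s t w : ℕ} (hd : s + t + w = m + 1)
    (h₀ : ¬ (t = 1 ∧ w = 1)) (h₁ : ¬ (s = 0 ∧ w = 1)) (h₂ : ¬ (s = 0 ∧ t = 1)) :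
    coeffAt (A i j k) ![s, t, w] = 0 := by
  obtain ⟨hij, hik, -, hjk, -, -⟩ := ne_of_eq_univ h
  have hF := hA _ _ _ _ h
  have hF' := hA _ _ _ _ (swap_first h)
  have hswap := coeffAt_swap hsym hij.symm hjk hik s t w
  obtain rfl | rfl | hs : s = 0 ∨ s = 1 ∨ 2 ≤ s := by omega
  · obtain rfl | ht : t = 0 ∨ 2 ≤ t := by omega
    · obtain ⟨v, rfl⟩ : ∃ v, w = v + 1 := ⟨w - 1, by omega⟩
      rw [hswap]
      exact coeffAt_zero_eq_zero hF' (by omega) (by omega) (by omega)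
    · obtain ⟨v, rfl⟩ : ∃ v, t = v + 1 := ⟨t - 1, by omega⟩
      exact coeffAt_zero_eq_zero hF (by omega) (by omega) (by omega)
  · obtain rfl | hm3 : m = 2 ∨ 3 ≤ m := by omega
    · obtain ⟨rfl, rfl⟩ | ⟨rfl, rfl⟩ : t = 2 ∧ w = 0 ∨ t = 0 ∧ w = 2 := by omega
      · exact coeffAt_square_eq_zero hsym hA h
      · rw [hswap]
        exact coeffAt_square_eq_zero hsym hA (swap_first h)
    · obtain rfl | ht : t = 0 ∨ 1 ≤ t := by omega
      · obtain ⟨v, rfl⟩ : ∃ v, w = v + 1 := ⟨w - 1, by omega⟩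
        rw [hswap]
        exact coeffAt_one_eq_zero hF' (by omega)
      · obtain ⟨v, rfl⟩ : ∃ v, t = v + 1 := ⟨t - 1, by omega⟩
        exact coeffAt_one_eq_zero hF (by omega)
  · obtain ⟨v, rfl⟩ : ∃ v, s = v + 2 := ⟨s - 2, by omega⟩
    exact coeffAt_high_eq_zero hF h₀

lemma coeffAt_high_eq_thirdIndex (hA : SixVarSystem A)
    (n : ℕ) {i j k : Fin 4} (hij : i ≠ j) (hik : i ≠ k)
    (hjk : j ≠ k) :
    coeffAt (A i j k) ![n + 1, 1, 1] = coeffAt (A i j (thirdIndex i j)) ![n + 1, 1, 1] := by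
  obtain h | h := eq_thirdIndex_or hij hik hjk
  · rw [← h]
  · exact coeffAt_high_congr (hA _ _ _ _ h) n

lemma coeffAt_mixed (hA : SixVarSystem A)
    (n : ℕ) {i j k : Fin 4} (hij : i ≠ j) (hik : i ≠ k) (hjk : j ≠ k) :
    coeffAt (A i j k) ![0, n + 2, 1] =
      -(coeffAt (A i k (thirdIndex i k)) ![n + 1, 1, 1] / (n + 2)) := by
  obtain ⟨l, h⟩ := exists_eq_univ hij hik hjk
  obtain ⟨-, -, hil, -, -, hkl⟩ := ne_of_eq_univ h
  have key := coeffAt_zero_add (hA _ _ _ _ h) (t := n + 1) (by omega)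
  rw [coeffAt_high_eq_thirdIndex hA n hik hil hkl] at key
  push_cast at key
  have hn : (n + 2 : ℝ) ≠ 0 := by positivity
  field_simp
  linear_combination key

end solution

lemma coeffAt_solution (n : ℕ) (a b c : ℝ) (s t w : ℕ) :
    coeffAt (X 1 * X 2 * (C a * X 0 ^ (n + 1) - C b * X 1 ^ (n + 1) - C c * X 2 ^ (n + 1)))
      ![s, t, w] =
    if t = 1 ∧ w = 1 ∧ s = n + 1 then a else if s = 0 ∧ t = n + 2 ∧ w = 1 then -b
      else if s = 0 ∧ t = 1 ∧ w = n + 2 then -c else 0 := by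
  simp [mul_assoc, coeffAt_X_mul, coeffAt_sub, coeffAt_C_mul, coeffAt_X_pow, funext_iff,
    Fin.forall_fin_succ, Function.update_apply, Pi.single_apply]
  rcases t with _ | t
  · simp
  rcases w with _ | w
  · simp
  simp only [Nat.add_one_ne_zero, if_false, Nat.add_sub_cancel]
  split_ifs <;> first | (exfalso; omega) | ring

theorem stmt_6 (m : ℕ) (hm : 2 ≤ m) (A : Fin 4 → Fin 4 → Fin 4 → MvPolynomial (Fin 3) ℝ)
    (hhom : ∀ i j k : Fin 4, i ≠ j → i ≠ k → j ≠ k → (A i j k).IsHomogeneous (m + 1))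
    (hsym : ∀ i j k : Fin 4, i ≠ j → i ≠ k → j ≠ k →
      A j i k = rename (Equiv.swap (1 : Fin 3) 2) (A i j k)) :
    SystemH A ↔
      ∃ b : Fin 4 → Fin 4 → ℝ, (∀ i j, b i j = b j i) ∧
        ∀ i j k : Fin 4, i ≠ j → i ≠ k → j ≠ k →
          A i j k = X 1 * X 2 * (C ((m : ℝ) * b i j) * X 0 ^ (m - 1) -
            C (b i k) * X 1 ^ (m - 1) - C (b j k) * X 2 ^ (m - 1)) := by
  rw [systemH_iff]
  obtain ⟨n, rfl⟩ : ∃ n, m = n + 2 := ⟨m - 2, by omega⟩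
  rw [show n + 2 - 1 = n + 1 by omega]
  constructor
  · intro hA
    refine ⟨fun i j => coeffAt (A i j (thirdIndex i j)) ![n + 1, 1, 1] / (n + 2),
      fun i j => ?_, fun i j k hij hik hjk => ?_⟩
    · obtain rfl | hij := eq_or_ne i j
      · rfl
      · dsimp only
        rw [thirdIndex_comm i j, coeffAt_swap hsym hij.symm (thirdIndex_ne j i).1
          (thirdIndex_ne j i).2]
    · obtain ⟨l, h⟩ := exists_eq_univ hij hik hjk
      have hn : (n + 2 : ℝ) ≠ 0 := by positivity
      ext d
      obtain ⟨s, t, w, rfl⟩ : ∃ s t w, d = Finsupp.equivFunOnFinite.symm ![s, t, w] :=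
        ⟨d 0, d 1, d 2, by ext x; fin_cases x <;> rfl⟩
      change coeffAt _ _ = coeffAt _ _
      rw [coeffAt_solution]
      split_ifs with h₀ h₁ h₂
      · obtain ⟨rfl, rfl, rfl⟩ := h₀
        rw [coeffAt_high_eq_thirdIndex hA n hij hik hjk]
        push_cast
        field_simp
      · obtain ⟨rfl, rfl, rfl⟩ := h₁
        exact coeffAt_mixed hA n hij hik hjk
      · obtain ⟨rfl, rfl, rfl⟩ := h₂
        rw [coeffAt_swap hsym hij.symm hjk hik]
        exact coeffAt_mixed hA n hij.symm hjk hik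
      · by_cases hd : s + t + w = n + 2 + 1
        · exact coeffAt_eq_zero hsym hA hm h hd (by omega) (by omega) (by omega)
        · refine (hhom i j k hij hik hjk).coeff_eq_zero ?_
          simpa [Finsupp.degree_eq_sum, Fin.sum_univ_succ, ← add_assoc] using hd
  · rintro ⟨b, hb, hA⟩ i j k l h
    obtain ⟨hij, hik, hil, hjk, hjl, hkl⟩ := ne_of_eq_univ h
    rw [hA i j k hij hik hjk, hA i j l hij hil hjl, hA j k l hjk hjl hkl, hA i k l hik hil hkl,
      hA j l k hjl hjk hkl.symm, hA i l k hil hik hkl.symm, hb l k]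
    simpa using sixVarForm_eq_zero n (b i j) (b i k) (b j k) (b i l) (b j l) (b k l)

end
end

section
/- The symmetric discrete Darboux system is 4D consistent: there exists ε ∈ (0,1) such that for all real initial data x_{ij} = x_{ji} (1 ≤ i < j ≤ 4) with |x_{ij}| < ε, all first-stage values T_k x_{ij} := D(x_{ij}, x_{ik}, x_{jk}) (for labels (ij;k)) satisfy |T_k x_{ij}| < 1, and for every {i,j,k,ℓ} = {1,2,3,4} the consistency equation D(T_ℓ x_{ij}, T_ℓ x_{ik}, T_ℓ x_{jk}) = D(T_k x_{ij}, T_k x_{iℓ}, T_k x_{jℓ}) holds, where D(x,y,z) = (x + yz)/(√(1−y²)·√(1−z²)). -/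
/- Statement 8: the symmetric discrete Darboux system
   `T_k x_{ij} = (x_{ij} + x_{ik} x_{jk}) / (√(1-x_{ik}²) √(1-x_{jk}²))`
   is 4D consistent for sufficiently small initial data. -/

noncomputable section

/-- The Darboux map `D(x,y,z) = (x + yz)/(√(1-y²)·√(1-z²))`. -/
def Dmap (x y z : ℝ) : ℝ := (x + y * z) / (Real.sqrt (1 - y ^ 2) * Real.sqrt (1 - z ^ 2))

/-- The two-step composition of the Darboux map, written so that its symmetry is visible. -/
theorem Dmap_Dmap (a b c d e f : ℝ) (hc : c ^ 2 < 1) (he : e ^ 2 < 1) (hf : f ^ 2 < 1) :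
    Dmap (Dmap a c e) (Dmap b c f) (Dmap d e f) =
      (a + c * e + b * d - a * f ^ 2 + b * e * f + c * d * f) /
        (√(1 - b ^ 2 - c ^ 2 - f ^ 2 - 2 * b * c * f) *
          √(1 - d ^ 2 - e ^ 2 - f ^ 2 - 2 * d * e * f)) := by
  have sqrt_one_sub_Dmap_sq : ∀ x y z : ℝ, y ^ 2 < 1 → z ^ 2 < 1 →
      √(1 - Dmap x y z ^ 2) =
        √(1 - x ^ 2 - y ^ 2 - z ^ 2 - 2 * x * y * z) / (√(1 - y ^ 2) * √(1 - z ^ 2)) := by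
    intro x y z hy hz
    have hY : 0 < √(1 - y ^ 2) := Real.sqrt_pos.2 (by linarith)
    have hZ : 0 < √(1 - z ^ 2) := Real.sqrt_pos.2 (by linarith)
    have hY2 : √(1 - y ^ 2) ^ 2 = 1 - y ^ 2 := Real.sq_sqrt (by linarith)
    have hZ2 : √(1 - z ^ 2) ^ 2 = 1 - z ^ 2 := Real.sq_sqrt (by linarith)
    have key : 1 - Dmap x y z ^ 2 =
        (1 - x ^ 2 - y ^ 2 - z ^ 2 - 2 * x * y * z) / (√(1 - y ^ 2) * √(1 - z ^ 2)) ^ 2 := by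
      rw [Dmap, div_pow, eq_div_iff (by positivity), sub_mul, div_mul_cancel₀ _ (by positivity),
        mul_pow, hY2, hZ2]
      ring
    rw [key, Real.sqrt_div' _ (by positivity), Real.sqrt_sq (by positivity)]
  rw [Dmap, sqrt_one_sub_Dmap_sq b c f hc hf, sqrt_one_sub_Dmap_sq d e f he hf]
  have hC : 0 < √(1 - c ^ 2) := Real.sqrt_pos.2 (by linarith)
  have hE : 0 < √(1 - e ^ 2) := Real.sqrt_pos.2 (by linarith)
  have hF : 0 < √(1 - f ^ 2) := Real.sqrt_pos.2 (by linarith)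
  have hF2 : √(1 - f ^ 2) ^ 2 = 1 - f ^ 2 := Real.sq_sqrt (by linarith)
  have hnum : Dmap a c e + Dmap b c f * Dmap d e f =
      (a + c * e + b * d - a * f ^ 2 + b * e * f + c * d * f) /
        (√(1 - c ^ 2) * √(1 - e ^ 2) * √(1 - f ^ 2) ^ 2) := by
    have h : a + c * e + b * d - a * f ^ 2 + b * e * f + c * d * f =
        (a + c * e) * √(1 - f ^ 2) ^ 2 + (b + c * f) * (d + e * f) := by
      rw [hF2]
      ring
    rw [h]
    simp only [Dmap]
    field_simp
  rw [hnum, div_mul_div_comm, div_div_eq_mul_div, div_mul_eq_mul_div, div_div]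
  rw [← mul_div_mul_right _ (√(1 - b ^ 2 - c ^ 2 - f ^ 2 - 2 * b * c * f) *
    √(1 - d ^ 2 - e ^ 2 - f ^ 2 - 2 * d * e * f)) (c := √(1 - c ^ 2) * √(1 - e ^ 2) *
    √(1 - f ^ 2) ^ 2) (by positivity)]
  congr 1 <;> ring

theorem abs_Dmap_lt_one {x y z : ℝ} (hx : |x| < 1 / 4) (hy : |y| < 1 / 4) (hz : |z| < 1 / 4) :
    |Dmap x y z| < 1 := by
  have le_sqrt_one_sub_sq : ∀ t : ℝ, |t| < 1 / 4 → 15 / 16 ≤ √(1 - t ^ 2) := fun t ht ↦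
    Real.le_sqrt_of_sq_le (by nlinarith [abs_nonneg t, sq_abs t])
  have hY := le_sqrt_one_sub_sq y hy
  have hZ := le_sqrt_one_sub_sq z hz
  rw [Dmap, abs_div, abs_of_pos (a := √(1 - y ^ 2) * √(1 - z ^ 2)) (by positivity),
    div_lt_one (by positivity)]
  have hyz : |y * z| ≤ 1 / 4 * (1 / 4) := by
    rw [abs_mul]
    gcongr
  nlinarith [abs_add_le x (y * z), mul_le_mul hY hZ (by norm_num) (by positivity)]

theorem stmt_8 :
    ∃ ε : ℝ, 0 < ε ∧ ε < 1 ∧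
      ∀ x : Fin 4 → Fin 4 → ℝ, (∀ i j, x i j = x j i) →
        (∀ i j : Fin 4, i ≠ j → |x i j| < ε) →
        (∀ i j k : Fin 4, i ≠ j → i ≠ k → j ≠ k →
            |Dmap (x i j) (x i k) (x j k)| < 1) ∧
          ∀ i j k l : Fin 4, ({i, j, k, l} : Finset (Fin 4)) = Finset.univ →
            Dmap (Dmap (x i j) (x i l) (x j l)) (Dmap (x i k) (x i l) (x k l))
                (Dmap (x j k) (x j l) (x k l)) =
              Dmap (Dmap (x i j) (x i k) (x j k)) (Dmap (x i l) (x i k) (x l k))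
                (Dmap (x j l) (x j k) (x l k)) := by
  refine ⟨1 / 4, by norm_num, by norm_num, fun x hsymm hx ↦ ⟨fun i j k hij hik hjk ↦
    abs_Dmap_lt_one (hx i j hij) (hx i k hik) (hx j k hjk), fun i j k l hijkl ↦ ?_⟩⟩
  have sq_lt : ∀ {i j}, i ≠ j → x i j ^ 2 < 1 := fun {i j} hij ↦
    (sq_lt_one_iff_abs_lt_one _).2 ((hx i j hij).trans (by norm_num))
  obtain ⟨hil, hjl, hkl, hik, hjk⟩ : i ≠ l ∧ j ≠ l ∧ k ≠ l ∧ i ≠ k ∧ j ≠ k := by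
    revert i j k l
    decide
  rw [hsymm l k, Dmap_Dmap _ _ _ _ _ _ (sq_lt hil) (sq_lt hjl) (sq_lt hkl),
    Dmap_Dmap _ _ _ _ _ _ (sq_lt hik) (sq_lt hjk) (sq_lt hkl)]
  ring_nf

end
end

section
/- The star-triangle map is 4D consistent: let x_{ij} (i ≠ j in {1,2,3,4}) be real (or complex) numbers with x_{ij} = −x_{ji}, and for distinct i,j,k set S_{ijk} := x_{ij} x_{jk} + x_{jk} x_{ki} + x_{ki} x_{ij} and T_k x_{ij} := −x_{ij}/S_{ijk} (this is well defined on unordered pairs since S_{ijk} is invariant under permutations of i,j,k compatible with the skew-symmetry convention, and T_k x_{ij} = −T_k x_{ji}). Assume that for every {i,j,k,ℓ} = {1,2,3,4} the first-stage denominators S_{ijk} are nonzero and the second-stage denominators (T_ℓ x_{ij})(T_ℓ x_{jk}) + (T_ℓ x_{jk})(T_ℓ x_{ki}) + (T_ℓ x_{ki})(T_ℓ x_{ij}) are nonzero. Then for every {i,j,k,ℓ} = {1,2,3,4} and every i < j one has T_ℓ(T_k x_{ij}) = T_k(T_ℓ x_{ij}), where T_ℓ(T_k x_{ij}) := −(T_ℓ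 x_{ij})/((T_ℓ x_{ij})(T_ℓ x_{jk}) + (T_ℓ x_{jk})(T_ℓ x_{ki}) + (T_ℓ x_{ki})(T_ℓ x_{ij})) and similarly with k and ℓ interchanged. -/
/- Statement 9: the star-triangle map
   `T_k x_{ij} = -x_{ij} / (x_{ij} x_{jk} + x_{jk} x_{ki} + x_{ki} x_{ij})`
   (for skew-symmetric fields `x_{ij} = -x_{ji}`) is 4D consistent, provided all first-stage
   and second-stage denominators are nonzero. -/

noncomputable section

/-- The star-triangle denominator `S_{ijk} = x_{ij} x_{jk} + x_{jk} x_{ki} + x_{ki} x_{ij}`. -/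
def Sden (x : Fin 4 → Fin 4 → ℝ) (i j k : Fin 4) : ℝ :=
  x i j * x j k + x j k * x k i + x k i * x i j

/-- The star-triangle map: `T_k x_{ij} = -x_{ij} / S_{ijk}`. -/
def Tmap (x : Fin 4 → Fin 4 → ℝ) (k i j : Fin 4) : ℝ := -(x i j) / Sden x i j k

/-- If the first-stage denominators do not vanish, the doubly transformed field
`T_k (T_l x_{ij})` has a closed form which is symmetric in `k` and `l`. -/
theorem Tmap_Tmap_eq_div (x : Fin 4 → Fin 4 → ℝ)
    (hskew : ∀ i j : Fin 4, i ≠ j → x i j = -x j i) {i j k l : Fin 4}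
    (hil : i ≠ l) (hjl : j ≠ l) (hkl : k ≠ l)
    (hijl : Sden x i j l ≠ 0) (hjkl : Sden x j k l ≠ 0) (hkil : Sden x k i l ≠ 0) :
    Tmap (fun p q => Tmap x l p q) k i j =
      x i j * Sden x j k l * Sden x k i l /
        (-(x i j * x j k * x i l * x k l + x j k * x k i * x i l * x j l +
          x i j * x k i * x j l * x k l)) := by
  have hN : x i j * x j k * Sden x k i l + x j k * x k i * Sden x i j l +
      x k i * x i j * Sden x j k l =
        -(x i j * x j k * x i l * x k l + x j k * x k i * x i l * x j l +
          x i j * x k i * x j l * x k l) := by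
    simp only [Sden, hskew l i hil.symm, hskew l j hjl.symm, hskew l k hkl.symm]
    ring
  have hS : Sden (fun p q => Tmap x l p q) i j k =
      (x i j * x j k * Sden x k i l + x j k * x k i * Sden x i j l +
        x k i * x i j * Sden x j k l) / (Sden x i j l * Sden x j k l * Sden x k i l) := by
    rw [Sden]
    simp only [Tmap]
    field_simp
  rw [← hN, Tmap, hS, Tmap]
  field_simp

theorem stmt_9 (x : Fin 4 → Fin 4 → ℝ)
    (hskew : ∀ i j : Fin 4, i ≠ j → x i j = -x j i)
    (h1 : ∀ i j k : Fin 4, i ≠ j → i ≠ k → j ≠ k → Sden x i j k ≠ 0)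
    (h2 : ∀ i j k l : Fin 4, ({i, j, k, l} : Finset (Fin 4)) = Finset.univ →
      Sden (fun p q => Tmap x l p q) i j k ≠ 0) :
    ∀ i j k l : Fin 4, ({i, j, k, l} : Finset (Fin 4)) = Finset.univ → i < j →
      Tmap (fun p q => Tmap x l p q) k i j = Tmap (fun p q => Tmap x k p q) l i j := by
  intro i j k l hu _
  obtain ⟨hij, hik, hil, hjk, hjl, hkl⟩ :
      i ≠ j ∧ i ≠ k ∧ i ≠ l ∧ j ≠ k ∧ j ≠ l ∧ k ≠ l := by
    revert i j k l
    decide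
  rw [Tmap_Tmap_eq_div x hskew hil hjl hkl (h1 i j l hij hil hjl) (h1 j k l hjk hjl hkl)
      (h1 k i l hik.symm hkl hil),
    Tmap_Tmap_eq_div x hskew hik hjk hkl.symm (h1 i j k hij hik hjk) (h1 j l k hjl hjk hkl.symm)
      (h1 l i k hil.symm hkl.symm hik)]
  simp only [Sden, hskew l i hil.symm, hskew l j hjl.symm, hskew l k hkl.symm,
    hskew k i hik.symm, hskew k j hjk.symm]
  congr 1 <;> ring

end
end

section
/- Let α_{ij;k} be nonzero complex numbers indexed by labels (ij;k) with i,j,k ∈ {1,2,3,4} and α_{ij;k} = α_{ji;k}. Then the conditions α_{ik;ℓ}·α_{ij;k} = α_{jℓ;k}·α_{ij;ℓ} hold for all {i,j,k,ℓ} = {1,2,3,4} if and only if there exist nonzero complex constants c_{ij} = c_{ji} (1 ≤ i < j ≤ 4) such that α_{ij;k} = c_{ik}·c_{jk}/c_{ij} for all labels (ij;k). -/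
/-- Four indices exhaust `Fin 4` exactly when they are pairwise distinct. -/
lemma insert_eq_univ_iff_pairwise_ne (i j k l : Fin 4) :
    ({i, j, k, l} : Finset (Fin 4)) = Finset.univ ↔
      i ≠ j ∧ i ≠ k ∧ i ≠ l ∧ j ≠ k ∧ j ≠ l ∧ k ≠ l := by
  revert i j k l
  decide

/-- The product `α_{ij;k} α_{ik;j}`, which is to become `c_{jk}²`, does not depend on `i`. -/
lemma mul_swap_eq_of_relations {α : Fin 4 → Fin 4 → Fin 4 → ℂ}
    (hsym : ∀ i j k, α i j k = α j i k)
    (hne : ∀ i j k : Fin 4, i ≠ j → i ≠ k → j ≠ k → α i j k ≠ 0)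
    (h : ∀ i j k l : Fin 4, ({i, j, k, l} : Finset (Fin 4)) = Finset.univ →
      α i k l * α i j k = α j l k * α i j l)
    {i j k l : Fin 4} (hij : i ≠ j) (hik : i ≠ k) (hil : i ≠ l) (hjk : j ≠ k) (hjl : j ≠ l)
    (hkl : k ≠ l) :
    α i j k * α i k j = α l j k * α l k j := by
  have h₁ := h i j k l ((insert_eq_univ_iff_pairwise_ne ..).2 ⟨hij, hik, hil, hjk, hjl, hkl⟩)
  have h₂ := h i k j l
    ((insert_eq_univ_iff_pairwise_ne ..).2 ⟨hik, hij, hil, hjk.symm, hkl, hjl⟩)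
  rw [hsym l j, hsym l k]
  apply mul_left_cancel₀ (mul_ne_zero (hne i k l hik hil hkl) (hne i j l hij hil hjl))
  linear_combination (α i j l * α i k j) * h₁ + (α j l k * α i j l) * h₂

/-- A simultaneous choice of the square roots `c_{0j}`. -/
lemma exists_sq_eq_of_relations {α : Fin 4 → Fin 4 → Fin 4 → ℂ}
    (hsym : ∀ i j k, α i j k = α j i k)
    (hne : ∀ i j k : Fin 4, i ≠ j → i ≠ k → j ≠ k → α i j k ≠ 0)
    (h : ∀ i j k l : Fin 4, ({i, j, k, l} : Finset (Fin 4)) = Finset.univ →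
      α i k l * α i j k = α j l k * α i j l) :
    ∃ r : Fin 4 → ℂ, ∀ j m, j ≠ 0 → m ≠ 0 → m ≠ j → r j ^ 2 = α m 0 j * α m j 0 := by
  have hex (j : Fin 4) : ∃ n : Fin 4, n ≠ 0 ∧ n ≠ j := by
    revert j
    decide
  choose n hn₀ hn using hex
  choose r hr using fun j ↦
    IsAlgClosed.exists_pow_nat_eq (α (n j) 0 j * α (n j) j 0) two_pos
  refine ⟨r, fun j m hj hm hmj ↦ ?_⟩
  rw [hr]
  obtain hmn | hmn := eq_or_ne (n j) m
  · rw [hmn]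
  · exact mul_swap_eq_of_relations hsym hne h (hn₀ j) (hn j) hmn hj.symm hm.symm hmj.symm

theorem stmt_10 (α : Fin 4 → Fin 4 → Fin 4 → ℂ)
    (hsym : ∀ i j k, α i j k = α j i k)
    (hne : ∀ i j k : Fin 4, i ≠ j → i ≠ k → j ≠ k → α i j k ≠ 0) :
    (∀ i j k l : Fin 4, ({i, j, k, l} : Finset (Fin 4)) = Finset.univ →
        α i k l * α i j k = α j l k * α i j l) ↔
      ∃ c : Fin 4 → Fin 4 → ℂ, (∀ i j, c i j = c j i) ∧ (∀ i j, i ≠ j → c i j ≠ 0) ∧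
        ∀ i j k : Fin 4, i ≠ j → i ≠ k → j ≠ k → α i j k = c i k * c j k / c i j := by
  constructor
  · intro h
    obtain ⟨r, hr⟩ := exists_sq_eq_of_relations hsym hne h
    have hr₀ (j : Fin 4) (hj : j ≠ 0) : r j ≠ 0 := by
      obtain ⟨m, hm, hmj⟩ : ∃ m : Fin 4, m ≠ 0 ∧ m ≠ j := by
        revert j
        decide
      rw [← pow_ne_zero_iff two_ne_zero, hr j m hj hm hmj]
      exact mul_ne_zero (hne _ _ _ hm hmj hj.symm) (hne _ _ _ hmj hm hj)
    have hα_zero (j k : Fin 4) (hj : j ≠ 0) (hk : k ≠ 0) (hjk : j ≠ k) :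
        α 0 j k = r k * (r j * r k / α j k 0) / r j := by
      have hrj := hr₀ j hj
      have hα := hne j k 0 hjk hj hk
      have hsq := hr k j hk hj hjk
      rw [hsym 0 j]
      field_simp
      linear_combination -hsq
    refine ⟨fun i j ↦ if i = 0 then r j else if j = 0 then r i else r i * r j / α i j 0,
      fun i j ↦ ?_, fun i j hij ↦ ?_, fun i j k hij hik hjk ↦ ?_⟩
    · dsimp only
      split_ifs with hi hj
      · rw [hi, hj]
      · rfl
      · rfl
      · rw [hsym i j, mul_comm]
    · dsimp only
      split_ifs with hi hj
      · exact hr₀ j fun hj ↦ hij (hi.trans hj.symm)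
      · exact hr₀ i hi
      · exact div_ne_zero (mul_ne_zero (hr₀ i hi) (hr₀ j hj)) (hne i j 0 hij hi hj)
    · obtain rfl | hi := eq_or_ne i 0
      · simpa [hij.symm, hik.symm] using hα_zero j k hij.symm hik.symm hjk
      obtain rfl | hj := eq_or_ne j 0
      · simpa [hi, hjk.symm, hsym i 0, mul_comm] using hα_zero i k hi hjk.symm hik
      have hri := hr₀ i hi
      have hrj := hr₀ j hj
      have hij0 := hne i j 0 hij hi hj
      obtain rfl | hk := eq_or_ne k 0
      · simp only [hi, hj, if_true, if_false]
        field_simp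
      have hik0 := hne i k 0 hik hi hk
      have hjk0 := hne j k 0 hjk hj hk
      have hrel := h j i k 0
        ((insert_eq_univ_iff_pairwise_ne ..).2 ⟨hij.symm, hjk, hj, hik, hi, hk⟩)
      have hsq := hr k i hk hi hik
      rw [hsym j i k, hsym j i 0] at hrel
      simp only [hi, hj, hk, if_false]
      field_simp
      linear_combination α i k 0 * hrel - α i j 0 * hsq
  · rintro ⟨c, hc, hc₀, hα⟩ i j k l hijkl
    obtain ⟨hij, hik, hil, hjk, hjl, hkl⟩ := (insert_eq_univ_iff_pairwise_ne ..).1 hijkl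
    rw [hα i k l hik hil hkl, hα i j k hij hik hjk, hα j l k hjl hjk hkl.symm,
      hα i j l hij hil hjl, hc l k]
    have := hc₀ i j hij
    have := hc₀ i k hik
    have := hc₀ j l hjl
    field_simp
end
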